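/- Let C⊥ ⊆ F₂²³ be the binary Golay code specified in the context. Then C⊥ is a perfect code of covering radius 3: for every vector u ∈ F₂²³ there exists exactly one codeword w ∈ C⊥ with Hamming distance d(u, w) ≤ 3. Equivalently, the closed Hamming balls of radius 3 centered at the codewords of C⊥ partition F₂²³. -/

import Mathlib

def golaySupports : Fin 11 → Finset (Fin 23) :=
  ![{1,4,7,8,9,10,11,22}, {0,3,6,7,8,9,10,21}, {1,2,4,5,6,10,11,20},
    {0,1,3,4,5,9,10,19}, {0,1,2,3,7,10,11,18}, {0,2,4,6,7,8,11,17},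
    {3,4,5,6,8,9,11,16}, {2,3,4,5,7,8,10,15}, {1,2,3,4,6,7,9,14},
    {0,1,2,3,5,6,8,13}, {0,2,5,8,9,10,11,12}]

def golayGen (i : Fin 11) : Fin 23 → ZMod 2 := fun j => if j ∈ golaySupports i then 1 else 0

def golayC : Submodule (ZMod 2) (Fin 23 → ZMod 2) :=
  Submodule.span (ZMod 2) (Set.range golayGen)

def golayDual : Submodule (ZMod 2) (Fin 23 → ZMod 2) where
  carrier := {u | ∀ w ∈ golayC, ∑ i, u i * w i = 0}
  zero_mem' := by intro w _; simp
  add_mem' := by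
    intro u v hu hv w hw
    simp only [Set.mem_setOf_eq] at hu hv ⊢
    simp only [Pi.add_apply, add_mul, Finset.sum_add_distrib, hu w hw, hv w hw, add_zero]
  smul_mem' := by
    intro c u hu w hw
    simp only [Set.mem_setOf_eq] at hu ⊢
    simp only [Pi.smul_apply, smul_eq_mul, mul_assoc, ← Finset.mul_sum, hu w hw, mul_zero]

/-- The parity-check map of the code `golayDual`. -/
def golaySyndrome : (Fin 23 → ZMod 2) →ₗ[ZMod 2] (Fin 11 → ZMod 2) :=
  Matrix.mulVecLin (Matrix.of golayGen)

theorem golaySyndrome_apply (u : Fin 23 → ZMod 2) (i : Fin 11) :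
    golaySyndrome u i = ∑ j, u j * golayGen i j := by
  simp [golaySyndrome, Matrix.mulVec, dotProduct, mul_comm]

theorem mem_golayDual_iff (u : Fin 23 → ZMod 2) : u ∈ golayDual ↔ golaySyndrome u = 0 := by
  constructor
  · intro h
    ext i
    rw [golaySyndrome_apply]
    exact h _ (Submodule.subset_span ⟨i, rfl⟩)
  · intro h w hw
    induction hw using Submodule.span_induction with
    | mem x hx =>
      obtain ⟨i, rfl⟩ := hx
      rw [← golaySyndrome_apply, h, Pi.zero_apply]
    | zero => simp
    | add x y _ _ hx hy => simp [mul_add, Finset.sum_add_distrib, hx, hy]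
    | smul c x _ hx => simp [mul_left_comm, ← Finset.mul_sum, hx]

/-- The vector of the eleven lowest binary digits of `n`. -/
def bitVector (n : ℕ) : Fin 11 → ZMod 2 := fun i => if n.testBit i then 1 else 0

theorem bitVector_zero : bitVector 0 = 0 := by
  ext i
  simp [bitVector]

theorem bitVector_xor (m n : ℕ) : bitVector (m ^^^ n) = bitVector m + bitVector n := by
  ext i
  simp only [bitVector, Nat.testBit_xor, Pi.add_apply]
  cases m.testBit i <;> cases n.testBit i <;> decide

theorem exists_bitVector_eq (t : Fin 11 → ZMod 2) : ∃ n < 2048, bitVector n = t := by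
  refine ⟨Nat.ofBits fun i => decide (t i = 1), Nat.ofBits_lt_two_pow _, ?_⟩
  ext i
  simp only [bitVector, Nat.testBit_ofBits_lt _ _ i.isLt, decide_eq_true_eq]
  generalize t i = x
  revert x
  decide

/-- The columns of the parity-check matrix, as binary numbers. -/
def golayColumn (j : Fin 23) : ℕ := Nat.ofBits fun i : Fin 11 => decide (j ∈ golaySupports i)

theorem bitVector_golayColumn (j : Fin 23) :
    bitVector (golayColumn j) = golaySyndrome (Pi.single j 1) := by
  ext i
  simp [golaySyndrome_apply, bitVector, golayColumn, Nat.testBit_ofBits_lt, golayGen,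
    Pi.single_apply]

/-- The columns of the parity-check matrix together with the zero column. -/
def golayColumns : List ℕ := 0 :: (List.finRange 23).map golayColumn

theorem exists_of_mem_golayColumns {n : ℕ} (hn : n ∈ golayColumns) :
    ∃ e : Fin 23 → ZMod 2, hammingNorm e ≤ 1 ∧ golaySyndrome e = bitVector n := by
  simp only [golayColumns, List.mem_cons, List.mem_map] at hn
  obtain rfl | ⟨j, -, rfl⟩ := hn
  · exact ⟨0, by simp, by rw [map_zero, bitVector_zero]⟩
  · refine ⟨Pi.single j 1, ?_, (bitVector_golayColumn j).symm⟩
    refine (Finset.card_le_card (t := {j}) fun k hk => ?_).trans_eq (Finset.card_singleton j)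
    by_contra hkj
    simp_all [Pi.single_apply]

/-- The bitwise disjunction of `f a` over the entries `a` of `l`. -/
def listOr (l : List ℕ) (f : ℕ → ℕ) : ℕ := l.foldr (fun a m => f a ||| m) 0

theorem exists_of_testBit_listOr {l : List ℕ} {f : ℕ → ℕ} {n : ℕ}
    (h : (listOr l f).testBit n = true) : ∃ a ∈ l, (f a).testBit n = true := by
  induction l with
  | nil => simp [listOr] at h
  | cons a l ih =>
    rw [listOr, List.foldr_cons, Nat.testBit_or, Bool.or_eq_true] at h
    obtain h | h := h
    · exact ⟨a, by simp, h⟩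
    · obtain ⟨b, hb, hbn⟩ := ih h
      exact ⟨b, by simp [hb], hbn⟩

theorem golayColumns_eq : golayColumns =
    [0, 1594, 797, 1972, 986, 493, 1740, 870, 435, 1763, 1355, 1183, 1141,
      1024, 512, 256, 128, 64, 32, 16, 8, 4, 2, 1] := by
  decide +kernel

theorem listOr_golayColumns :
    (listOr golayColumns fun a => listOr golayColumns fun b => listOr golayColumns fun c =>
      2 ^ (a ^^^ b ^^^ c)) = 2 ^ 2048 - 1 := by
  rw [golayColumns_eq]
  decide +kernel

theorem hammingNorm_add_le {ι : Type*} {β : ι → Type*} [Fintype ι] [∀ i, AddGroup (β i)]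
    [∀ i, DecidableEq (β i)] (x y : ∀ i, β i) :
    hammingNorm (x + y) ≤ hammingNorm x + hammingNorm y := by
  have h := hammingDist_triangle 0 x (x + y)
  rwa [hammingDist_eq_hammingNorm x, neg_add_cancel_left, hammingDist_zero_left] at h

theorem exists_golaySyndrome_eq (t : Fin 11 → ZMod 2) :
    ∃ e : Fin 23 → ZMod 2, hammingNorm e ≤ 3 ∧ golaySyndrome e = t := by
  obtain ⟨n, hn, rfl⟩ := exists_bitVector_eq t
  have h : (2 ^ 2048 - 1 : ℕ).testBit n = true := by
    rw [Nat.testBit_two_pow_sub_one, decide_eq_true hn]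
  rw [← listOr_golayColumns] at h
  obtain ⟨a, ha, h⟩ := exists_of_testBit_listOr h
  obtain ⟨b, hb, h⟩ := exists_of_testBit_listOr h
  obtain ⟨c, hc, h⟩ := exists_of_testBit_listOr h
  rw [Nat.testBit_two_pow, decide_eq_true_eq] at h
  obtain ⟨x, hx, hxa⟩ := exists_of_mem_golayColumns ha
  obtain ⟨y, hy, hyb⟩ := exists_of_mem_golayColumns hb
  obtain ⟨z, hz, hzc⟩ := exists_of_mem_golayColumns hc
  refine ⟨x + y + z, ?_, ?_⟩
  · have h₁ := hammingNorm_add_le (x + y) z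
    have h₂ := hammingNorm_add_le x y
    omega
  · rw [map_add, map_add, hxa, hyb, hzc, ← bitVector_xor, ← bitVector_xor, h]

theorem card_hammingNorm_le_three :
    (Finset.univ.filter fun e : Fin 23 → ZMod 2 => hammingNorm e ≤ 3).card ≤ 2048 := by
  let T := (Finset.range 4).biUnion fun k => Finset.powersetCard k (Finset.univ : Finset (Fin 23))
  have hT : T.card ≤ 2048 := by
    refine Finset.card_biUnion_le.trans ?_
    simp only [Finset.card_powersetCard, Finset.card_univ, Fintype.card_fin]
    decide
  refine (Finset.card_le_card_of_injOn
    (fun e => Finset.univ.filter fun i => e i ≠ 0) ?_ ?_).trans hT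
  · intro e he
    have he' : hammingNorm e ≤ 3 := by simpa using he
    simp only [T, Finset.coe_biUnion, Set.mem_iUnion, Finset.mem_coe, Finset.mem_powersetCard,
      Finset.mem_range]
    exact ⟨_, Nat.lt_succ_of_le he', Finset.subset_univ _, rfl⟩
  · intro e _ f _ h
    ext i
    have hi : e i ≠ 0 ↔ f i ≠ 0 := by simpa using Finset.ext_iff.mp h i
    revert hi
    generalize e i = x
    generalize f i = y
    revert x y
    decide

theorem eq_of_golaySyndrome_eq {e f : Fin 23 → ZMod 2} (he : hammingNorm e ≤ 3)
    (hf : hammingNorm f ≤ 3) (h : golaySyndrome e = golaySyndrome f) : e = f := by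
  have hinj := Finset.injOn_of_surjOn_of_card_le
    (s := Finset.univ.filter fun e : Fin 23 → ZMod 2 => hammingNorm e ≤ 3)
    (t := (Finset.univ : Finset (Fin 11 → ZMod 2))) golaySyndrome
    (fun _ _ => by simp)
    (fun t _ => by
      obtain ⟨e, he, rfl⟩ := exists_golaySyndrome_eq t
      exact ⟨e, by simpa using he, rfl⟩)
    (card_hammingNorm_le_three.trans_eq (by simp [ZMod.card]))
  exact hinj (by simpa using he) (by simpa using hf) h

theorem stmt_14 :
    ∀ u : Fin 23 → ZMod 2, ∃! w : Fin 23 → ZMod 2, w ∈ golayDual ∧ hammingDist u w ≤ 3 := by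
  intro u
  obtain ⟨e, he, hes⟩ := exists_golaySyndrome_eq (-golaySyndrome u)
  refine ⟨u + e, ⟨?_, ?_⟩, ?_⟩
  · rw [mem_golayDual_iff, map_add, hes, add_neg_cancel]
  · rwa [hammingDist_eq_hammingNorm, neg_add_cancel_left]
  · rintro w ⟨hw, hd⟩
    rw [mem_golayDual_iff] at hw
    rw [hammingDist_eq_hammingNorm] at hd
    have h : -u + w = e :=
      eq_of_golaySyndrome_eq hd he (by rw [map_add, map_neg, hw, add_zero, hes])
    rw [← h, add_neg_cancel_left]
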